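/- arXiv:0804.2049 — 2 statements merged into one kernel-verified Lean document; each statement's English description precedes it below -/
import Mathlib

section
/- An element a of the Zorn vector-matrix algebra C(F) over a field F is invertible if and only if n(a) ≠ 0; more precisely: if n(a) ≠ 0 then, setting b = n(a)⁻¹ • (t(a) • 1 − a), one has a ∘ b = 1 and b ∘ a = 1; and conversely, if there exists b with a ∘ b = 1, then n(a) ≠ 0. -/
/-- Underlying set of the Zorn vector-matrix (split Cayley–Dickson) algebra over `F`:
an element `(α₁, α₁₂, α₂₁, α₂)` is the 2×2 matrix with scalar diagonal entries
`α₁, α₂` and vector off-diagonal entries `α₁₂, α₂₁`. -/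
abbrev ZornAlg (F : Type*) : Type _ := F × (Fin 3 → F) × (Fin 3 → F) × F

/-- Dot product on `Fin 3 → F`. -/
def dot3 {F : Type*} [Field F] (x y : Fin 3 → F) : F := ∑ i, x i * y i

/-- Cross product on `Fin 3 → F`. -/
def cross3 {F : Type*} [Field F] (x y : Fin 3 → F) : Fin 3 → F :=
  ![x 1 * y 2 - x 2 * y 1, x 2 * y 0 - x 0 * y 2, x 0 * y 1 - x 1 * y 0]

/-- Zorn vector-matrix multiplication. -/
def zmul {F : Type*} [Field F] (a b : ZornAlg F) : ZornAlg F :=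
  (a.1 * b.1 + dot3 a.2.1 b.2.2.1,
   a.1 • b.2.1 + b.2.2.2 • a.2.1 - cross3 a.2.2.1 b.2.2.1,
   b.1 • a.2.2.1 + a.2.2.2 • b.2.2.1 + cross3 a.2.1 b.2.1,
   a.2.2.2 * b.2.2.2 + dot3 a.2.2.1 b.2.1)

/-- The unit `1 = (1, 0, 0, 1)` of the Zorn algebra. -/
def zornOne (F : Type*) [Field F] : ZornAlg F := (1, 0, 0, 1)

/-- Trace `t(a) = α₁ + α₂`. -/
def ztrace {F : Type*} [Field F] (a : ZornAlg F) : F := a.1 + a.2.2.2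

/-- Norm `n(a) = α₁ α₂ − α₁₂ ⋅ α₂₁`. -/
def znorm {F : Type*} [Field F] (a : ZornAlg F) : F := a.1 * a.2.2.2 - dot3 a.2.1 a.2.2.1

/-- The norm of the Zorn algebra is multiplicative. -/
theorem znorm_zmul {F : Type*} [Field F] (a b : ZornAlg F) :
    znorm (zmul a b) = znorm a * znorm b := by
  simp [znorm, zmul, dot3, cross3, Fin.sum_univ_three, Matrix.vecHead, Matrix.vecTail]
  ring

theorem znorm_zornOne {F : Type*} [Field F] : znorm (zornOne F) = 1 := by
  simp [znorm, zornOne, dot3]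

theorem zmul_smul {F : Type*} [Field F] (c : F) (a b : ZornAlg F) :
    zmul a (c • b) = c • zmul a b := by
  ext i <;> (try fin_cases i) <;>
    simp [zmul, dot3, cross3, Fin.sum_univ_three, Matrix.vecHead, Matrix.vecTail] <;>
    ring

theorem smul_zmul {F : Type*} [Field F] (c : F) (a b : ZornAlg F) :
    zmul (c • a) b = c • zmul a b := by
  ext i <;> (try fin_cases i) <;>
    simp [zmul, dot3, cross3, Fin.sum_univ_three, Matrix.vecHead, Matrix.vecTail] <;>
    ring

/-- The product of `a` with its conjugate `t(a) • 1 - a` is `n(a) • 1`. -/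
theorem zmul_conj {F : Type*} [Field F] (a : ZornAlg F) :
    zmul a (ztrace a • zornOne F - a) = znorm a • zornOne F := by
  ext i <;> (try fin_cases i) <;>
    simp [zmul, znorm, ztrace, zornOne, dot3, cross3, Fin.sum_univ_three] <;> ring

/-- The product of the conjugate `t(a) • 1 - a` with `a` is `n(a) • 1`. -/
theorem conj_zmul {F : Type*} [Field F] (a : ZornAlg F) :
    zmul (ztrace a • zornOne F - a) a = znorm a • zornOne F := by
  ext i <;> (try fin_cases i) <;>
    simp [zmul, znorm, ztrace, zornOne, dot3, cross3, Fin.sum_univ_three] <;> ring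

/-- An element `a` of the Zorn algebra is invertible iff `n(a) ≠ 0`: if `n(a) ≠ 0` then
`b = n(a)⁻¹ • (t(a) • 1 − a)` is a two-sided inverse of `a`; conversely if `a` has a right
inverse then `n(a) ≠ 0`. -/
theorem zorn_invertible_iff_norm_ne_zero {F : Type*} [Field F] (a : ZornAlg F) :
    (znorm a ≠ 0 →
      zmul a ((znorm a)⁻¹ • (ztrace a • zornOne F - a)) = zornOne F ∧
      zmul ((znorm a)⁻¹ • (ztrace a • zornOne F - a)) a = zornOne F) ∧
    ((∃ b : ZornAlg F, zmul a b = zornOne F) → znorm a ≠ 0) := by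
  refine ⟨fun h => ⟨?_, ?_⟩, ?_⟩
  · rw [zmul_smul, zmul_conj, inv_smul_smul₀ h]
  · rw [smul_zmul, conj_zmul, inv_smul_smul₀ h]
  · rintro ⟨b, hb⟩ h
    have hn := znorm_zmul a b
    rw [hb, znorm_zornOne, h, zero_mul] at hn
    exact one_ne_zero hn
end

section
/- (Commutator formula, Lemma 12.) Let A be a unital alternative ring, m a natural number, and u, v in A with u^[m] = 0 and v^[m] = 0 (right-normed powers). Set a = 1 − u, b = 1 − v, Su = ∑_{i < m} u^[i], Sv = ∑_{i < m} v^[i]. Then the loop commutator of a and b in the loop of invertible elements of A satisfies: (b * a) * (1 + (Su * Sv) * (u * v − v * u)) = a * b. -/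
namespace AlternativeRing

variable {A : Type*} [NonAssocRing A]

/-- The left alternative law, linearized. -/
theorem left_alternative_polarized (hl : ∀ x y : A, (x * x) * y = x * (x * y)) (x y z : A) :
    (x * y) * z + (y * x) * z = x * (y * z) + y * (x * z) := by
  have h := hl (x + y) z
  simp only [add_mul, mul_add, hl] at h
  grind

/-- The right alternative law, linearized. -/
theorem right_alternative_polarized (hr : ∀ x y : A, (y * x) * x = y * (x * x)) (x y z : A) :
    (z * x) * y + (z * y) * x = z * (x * y) + z * (y * x) := by
  have h := hr (x + y) z
  simp only [add_mul, mul_add, hr] at h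
  grind

theorem flexible (hl : ∀ x y : A, (x * x) * y = x * (x * y))
    (hr : ∀ x y : A, (y * x) * x = y * (x * x)) (x y : A) : (x * y) * x = x * (y * x) := by
  have h := left_alternative_polarized hl x y x
  have h' := hr x y
  grind

theorem left_moufang (hl : ∀ x y : A, (x * x) * y = x * (x * y))
    (hr : ∀ x y : A, (y * x) * x = y * (x * x)) (a x y : A) :
    ((a * x) * a) * y = a * (x * (a * y)) := by
  have h₁ := left_alternative_polarized hl (a * x) a y
  have h₂ := right_alternative_polarized hr x (a * y) a
  have h₃ := right_alternative_polarized hr x y (a * a)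
  have h₄ := congrArg (a * ·) (right_alternative_polarized hr x y a)
  simp only [mul_add, hl] at h₁ h₂ h₃ h₄
  grind

theorem middle_moufang (hl : ∀ x y : A, (x * x) * y = x * (x * y))
    (hr : ∀ x y : A, (y * x) * x = y * (x * x)) (a x y : A) :
    (a * x) * (y * a) = (a * (x * y)) * a := by
  have h₁ := right_alternative_polarized hr x (y * a) a
  have h₂ := left_moufang hl hr a y x
  rw [flexible hl hr] at h₂
  have h₃ := congrArg (a * ·) (left_alternative_polarized hl x y a)
  have h₄ := congrArg (a * ·) (right_alternative_polarized hr a x y)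
  have h₅ := flexible hl hr a (x * y)
  simp only [mul_add] at h₁ h₂ h₃ h₄
  grind

/-- The left inverse property of an alternative ring. -/
theorem mul_inv_mul_cancel (hl : ∀ x y : A, (x * x) * y = x * (x * y))
    (hr : ∀ x y : A, (y * x) * x = y * (x * x))
    {a b : A} (hab : a * b = 1) (hba : b * a = 1) (x : A) :
    a * (b * x) = x := by
  have hone : (a * (b * b)) * a = 1 := by rw [← hr, hab, one_mul, hba]
  have key (y : A) : a * (b * (b * (a * y))) = y := by
    rw [← hl b, ← left_moufang hl hr, hone, one_mul]
  have hcancel (y : A) : a * (b * (a * y)) = a * y := by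
    rw [← left_moufang hl hr, hab, one_mul]
  conv_lhs => rw [← key x, hcancel, key]

/-- The right inverse property of an alternative ring. -/
theorem mul_mul_inv_cancel (hl : ∀ x y : A, (x * x) * y = x * (x * y))
    (hr : ∀ x y : A, (y * x) * x = y * (x * x))
    {a b : A} (hab : a * b = 1) (hba : b * a = 1) (x : A) :
    (x * a) * b = x := by
  have h := mul_inv_mul_cancel (A := Aᵐᵒᵖ) (a := .op b) (b := .op a)
    (fun p q => congrArg MulOpposite.op (hr p.unop q.unop).symm)
    (fun p q => congrArg MulOpposite.op (hl p.unop q.unop).symm)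
    (congrArg MulOpposite.op hab) (congrArg MulOpposite.op hba) (.op x)
  exact congrArg MulOpposite.unop h

theorem mul_mul_inv_mul_inv (hl : ∀ x y : A, (x * x) * y = x * (x * y))
    (hr : ∀ x y : A, (y * x) * x = y * (x * x)) {a a' b b' : A} (ha : a * a' = 1) (ha' : a' * a = 1)
    (hb : b * b' = 1) (hb' : b' * b = 1) : (b * a) * (a' * b') = 1 := by
  have h : a' * b' = (a' * (b' * b')) * b := by
    rw [← hr, mul_mul_inv_cancel hl hr hb' hb]
  rw [h, middle_moufang hl hr, mul_inv_mul_cancel hl hr ha ha', ← hr, hb, one_mul, hb']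

theorem mul_iterate_mul_right_one (hl : ∀ x y : A, (x * x) * y = x * (x * y))
    (hr : ∀ x y : A, (y * x) * x = y * (x * x)) (u : A) (n : ℕ) :
    u * (fun y => y * u)^[n] 1 = (fun y => y * u)^[n + 1] 1 := by
  induction n with
  | zero => simp
  | succ n ih =>
    rw [Function.iterate_succ_apply', ← flexible hl hr, ih,
      ← Function.iterate_succ_apply' (fun y => y * u)]

theorem sum_iterate_mul_one_sub {m : ℕ} {u : A} (hu : (fun y => y * u)^[m] (1 : A) = 0) :
    (∑ i ∈ Finset.range m, (fun y => y * u)^[i] (1 : A)) * (1 - u) = 1 := by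
  rw [Finset.sum_mul]
  simp only [mul_sub, mul_one, ← Function.iterate_succ_apply' (fun y => y * u)]
  rw [Finset.sum_range_sub', hu]
  simp

theorem one_sub_mul_sum_iterate (hl : ∀ x y : A, (x * x) * y = x * (x * y))
    (hr : ∀ x y : A, (y * x) * x = y * (x * x))
    {m : ℕ} {u : A} (hu : (fun y => y * u)^[m] (1 : A) = 0) :
    (1 - u) * (∑ i ∈ Finset.range m, (fun y => y * u)^[i] (1 : A)) = 1 := by
  rw [Finset.mul_sum]
  simp only [sub_mul, one_mul, mul_iterate_mul_right_one hl hr]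
  rw [Finset.sum_range_sub', hu]
  simp

end AlternativeRing

open AlternativeRing

/-- Commutator formula (Lemma 12): in a unital alternative ring, for `u, v` with vanishing
right-normed `m`-th powers and `a = 1 − u`, `b = 1 − v`, the loop commutator of `a` and `b`
is `1 + (Su Sv)(uv − vu)` where `Sx = ∑_{i<m} x^[i]`, i.e.
`(ba) ⬝ (1 + (Su Sv)(uv − vu)) = ab`. -/
theorem alternative_loop_commutator_formula {A : Type*} [NonAssocRing A]
    (hl : ∀ x y : A, (x * x) * y = x * (x * y))
    (hr : ∀ x y : A, (y * x) * x = y * (x * x))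
    (m : ℕ) (u v : A)
    (hu : (fun y => y * u)^[m] (1 : A) = 0)
    (hv : (fun y => y * v)^[m] (1 : A) = 0) :
    ((1 - v) * (1 - u)) *
      (1 + ((∑ i ∈ Finset.range m, (fun y => y * u)^[i] (1 : A)) *
            (∑ i ∈ Finset.range m, (fun y => y * v)^[i] (1 : A))) *
        (u * v - v * u)) =
    (1 - u) * (1 - v) := by
  have hau := one_sub_mul_sum_iterate hl hr hu
  have hua := sum_iterate_mul_one_sub hu
  have hbv := one_sub_mul_sum_iterate hl hr hv
  have hvb := sum_iterate_mul_one_sub hv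
  rw [mul_add, mul_one, mul_inv_mul_cancel hl hr (mul_mul_inv_mul_inv hl hr hau hua hbv hvb)
    (mul_mul_inv_mul_inv hl hr hvb hbv hua hau)]
  simp only [sub_mul, mul_sub, one_mul, mul_one]
  abel
end
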